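/- arXiv:2312.15315 — 3 statements merged into one kernel-verified Lean document; each statement's English description precedes it below -/
import Mathlib

section
/- Let (Ω, 𝔽, P) be a probability space, n, J ≥ 1 integers, and c ∈ ℝⁿ a fixed vector with c ≥ 0 componentwise. Let a₁ : Ω → ℝⁿ and b₁ : Ω → ℝ be random variables and set L := a₁ᵀc + b₁; assume L has law N(m, s²) for some m ∈ ℝ and s > 0. Let D = (a₂, b₂, γ) : Ω → ℝⁿ × ℝ × ℝ be a random element taking only the values (a₂ʲ, b₂ʲ, r_j), j = 1, …, J, with P(D = (a₂ʲ, b₂ʲ, r_j)) = p_j, where p_j > 0, Σ_j p_j = 1, a₂ʲ ≥ 0 componentwise and b₂ʲ > 0 (so a₂ᵀc + b₂ > 0 always). Assume L and D are independent, and let ε ∈ (0,1). Then P( (a₁ᵀc + b₁)/(a₂ᵀc + b₂) ≤ γ ) ≥ 1 − ε holds if and only if there exist z_1, …, z_J ∈ (0,1) and q_1, …, q_J ∈ ℝ with Φ(q_j) = z_j for all j, Σ_{j=1}^J p_j z_j ≥ 1 − ε, and m + q_j · s ≤ r_j (a₂ʲᵀ c + b₂ʲ) for every j = 1, …, J. 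-/
open MeasureTheory ProbabilityTheory

/-- `Φ`, the cumulative distribution function of the standard Gaussian
distribution `N(0,1)` on `ℝ`. -/
noncomputable def stdGaussianCDF (t : ℝ) : ℝ :=
  (ProbabilityTheory.gaussianReal 0 1 (Set.Iic t)).toReal

theorem gaussianReal_Iic_toReal (m s t : ℝ) (hs : 0 < s) :
    (gaussianReal m ⟨s ^ 2, sq_nonneg s⟩ (Set.Iic t)).toReal =
      stdGaussianCDF ((t - m) / s) := by
  have hmap : (gaussianReal 0 1).map (fun x => s * x + m) =
      gaussianReal m ⟨s ^ 2, sq_nonneg s⟩ := by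
    have hcomp : (fun x : ℝ => s * x + m) = (· + m) ∘ (s * ·) := rfl
    rw [hcomp, ← Measure.map_map (by fun_prop) (by fun_prop), gaussianReal_map_const_mul,
      gaussianReal_map_add_const]
    simp
    rfl
  have hpre : (fun x => s * x + m) ⁻¹' Set.Iic t = Set.Iic ((t - m) / s) := by
    ext x
    simp only [Set.mem_preimage, Set.mem_Iic, le_div_iff₀ hs]
    constructor <;> intro h <;> linarith
  rw [← hmap, Measure.map_apply (by fun_prop) measurableSet_Iic, hpre, stdGaussianCDF]

theorem stdGaussianCDF_mono : Monotone stdGaussianCDF := fun _ _ h =>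
  ENNReal.toReal_mono (measure_ne_top _ _) (measure_mono (Set.Iic_subset_Iic.2 h))

theorem gaussianReal_ne_zero_of_volume_ne_zero {A : Set ℝ} (hA : volume A ≠ 0) :
    gaussianReal 0 1 A ≠ 0 := fun h =>
  hA (gaussianReal_absolutelyContinuous' 0 one_ne_zero h)

theorem stdGaussianCDF_mem_Ioo (t : ℝ) : stdGaussianCDF t ∈ Set.Ioo (0 : ℝ) 1 := by
  have hIic : 0 < stdGaussianCDF t :=
    ENNReal.toReal_pos (gaussianReal_ne_zero_of_volume_ne_zero (by simp)) (measure_ne_top _ _)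
  have hIoi : 0 < (gaussianReal 0 1).real (Set.Iic t)ᶜ :=
    ENNReal.toReal_pos (gaussianReal_ne_zero_of_volume_ne_zero (by simp)) (measure_ne_top _ _)
  rw [probReal_compl_eq_one_sub measurableSet_Iic] at hIoi
  exact ⟨hIic, sub_pos.1 hIoi⟩

/-- A covering family of values whose probabilities are positive and sum to one has no
repetitions. -/
theorem injective_of_sum_prob_eq_one {Ω E ι : Type*} [MeasurableSpace Ω] [Fintype ι]
    (P : Measure Ω) [IsProbabilityMeasure P] (D : Ω → E) (d : ι → E)
    (hvals : ∀ ω, ∃ j, D ω = d j) (hpos : ∀ j, 0 < P.real (D ⁻¹' {d j}))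
    (hsum : ∑ j, P.real (D ⁻¹' {d j}) = 1) : Function.Injective d := by
  classical
  intro i j hij
  by_contra hne
  have hcover : (⋃ k ∈ Finset.univ.erase i, D ⁻¹' {d k}) = Set.univ := by
    refine Set.eq_univ_of_forall fun ω => ?_
    obtain ⟨k, hk⟩ := hvals ω
    rw [Set.mem_iUnion₂]
    by_cases hki : k = i
    · exact ⟨j, by simp [Ne.symm hne], by simp [hk, hki, hij]⟩
    · exact ⟨k, by simp [hki], by simp [hk]⟩
  have hle := measureReal_biUnion_finset_le (μ := P) (Finset.univ.erase i)
    (fun k => D ⁻¹' {d k})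
  rw [hcover, probReal_univ] at hle
  have hsplit := Finset.add_sum_erase Finset.univ (fun k => P.real (D ⁻¹' {d k}))
    (Finset.mem_univ i)
  linarith [hpos i]

theorem prob_iUnion_inter_of_indepFun {Ω E ι : Type*} [MeasurableSpace Ω] [Fintype ι]
    [MeasurableSpace E] [MeasurableSingletonClass E]
    (P : Measure Ω) [IsProbabilityMeasure P] {L : Ω → ℝ} {D : Ω → E}
    (hL : Measurable L) (hD : Measurable D) (hindep : IndepFun L D P)
    {d : ι → E} (hd : Function.Injective d) (t : ι → ℝ) :
    P.real (⋃ j, L ⁻¹' Set.Iic (t j) ∩ D ⁻¹' {d j}) =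
      ∑ j, P.real (D ⁻¹' {d j}) * P.real (L ⁻¹' Set.Iic (t j)) := by
  rw [measureReal_iUnion_fintype]
  · refine Finset.sum_congr rfl fun j _ => ?_
    rw [measureReal_def, hindep.measure_inter_preimage_eq_mul _ _ measurableSet_Iic
      (measurableSet_singleton _), ENNReal.toReal_mul, mul_comm]
    rfl
  · intro i j hij
    refine Set.disjoint_left.2 fun ω hi hj => hij (hd ?_)
    exact hi.2.symm.trans hj.2
  · exact fun j => (hL measurableSet_Iic).inter (hD (measurableSet_singleton _))

theorem stmt_1 {Ω : Type*} [MeasurableSpace Ω] (P : Measure Ω) [IsProbabilityMeasure P]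
    (n J : ℕ) (hn : 1 ≤ n) (hJ : 1 ≤ J)
    (c : Fin n → ℝ) (hc : ∀ i, 0 ≤ c i)
    (a₁ : Ω → Fin n → ℝ) (b₁ : Ω → ℝ)
    (L : Ω → ℝ) (hL : L = fun ω => (∑ i, a₁ ω i * c i) + b₁ ω)
    (hLmeas : Measurable L) (m s : ℝ) (hs : 0 < s)
    (hLlaw : P.map L = ProbabilityTheory.gaussianReal m ⟨s ^ 2, sq_nonneg s⟩)
    (D : Ω → (Fin n → ℝ) × ℝ × ℝ) (hDmeas : Measurable D)
    (a₂ : Fin J → Fin n → ℝ) (b₂ : Fin J → ℝ) (r : Fin J → ℝ) (p : Fin J → ℝ)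
    (hDvals : ∀ ω, ∃ j, D ω = (a₂ j, b₂ j, r j))
    (hDlaw : ∀ j, (P {ω | D ω = (a₂ j, b₂ j, r j)}).toReal = p j)
    (hp : ∀ j, 0 < p j) (hpsum : ∑ j, p j = 1)
    (ha₂ : ∀ j i, 0 ≤ a₂ j i) (hb₂ : ∀ j, 0 < b₂ j)
    (hindep : ProbabilityTheory.IndepFun L D P)
    (ε : ℝ) (hε : ε ∈ Set.Ioo (0 : ℝ) 1) :
    1 - ε ≤ (P {ω | ((∑ i, a₁ ω i * c i) + b₁ ω) /
        ((∑ i, (D ω).1 i * c i) + (D ω).2.1) ≤ (D ω).2.2}).toReal ↔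
      ∃ z q : Fin J → ℝ, (∀ j, z j ∈ Set.Ioo (0 : ℝ) 1) ∧
        (∀ j, stdGaussianCDF (q j) = z j) ∧
        (1 - ε ≤ ∑ j, p j * z j) ∧
        (∀ j, m + q j * s ≤ r j * ((∑ i, a₂ j i * c i) + b₂ j)) := by
  have hden : ∀ j, 0 < (∑ i, a₂ j i * c i) + b₂ j := fun j =>
    add_pos_of_nonneg_of_pos (Finset.sum_nonneg fun i _ => mul_nonneg (ha₂ j i) (hc i)) (hb₂ j)
  let d : Fin J → (Fin n → ℝ) × ℝ × ℝ := fun j => (a₂ j, b₂ j, r j)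
  let t : Fin J → ℝ := fun j => r j * ((∑ i, a₂ j i * c i) + b₂ j)
  have hDp : ∀ j, P.real (D ⁻¹' {d j}) = p j := hDlaw
  have hd : Function.Injective d :=
    injective_of_sum_prob_eq_one P D d hDvals (fun j => by rw [hDp]; exact hp j)
      (by simpa only [hDp] using hpsum)
  have hset : {ω | ((∑ i, a₁ ω i * c i) + b₁ ω) /
      ((∑ i, (D ω).1 i * c i) + (D ω).2.1) ≤ (D ω).2.2} =
      ⋃ j, L ⁻¹' Set.Iic (t j) ∩ D ⁻¹' {d j} := by
    have hiff : ∀ ω j, D ω = d j → (((∑ i, a₁ ω i * c i) + b₁ ω) /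
        ((∑ i, (D ω).1 i * c i) + (D ω).2.1) ≤ (D ω).2.2 ↔ L ω ≤ t j) := by
      intro ω j hj
      rw [hj, hL]
      exact div_le_iff₀ (hden j)
    ext ω
    simp only [Set.mem_ofPred_eq, Set.mem_iUnion, Set.mem_inter_iff, Set.mem_preimage,
      Set.mem_Iic, Set.mem_singleton_iff]
    constructor
    · intro h
      obtain ⟨j, hj⟩ := hDvals ω
      exact ⟨j, (hiff ω j hj).1 h, hj⟩
    · rintro ⟨j, h, hj⟩
      exact (hiff ω j hj).2 h
  have hLcdf : ∀ x, P.real (L ⁻¹' Set.Iic x) = stdGaussianCDF ((x - m) / s) := by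
    intro x
    rw [← gaussianReal_Iic_toReal m s x hs, ← hLlaw,
      Measure.map_apply hLmeas measurableSet_Iic, measureReal_def]
  have hprob := prob_iUnion_inter_of_indepFun P hLmeas hDmeas hindep hd t
  simp only [hDp, hLcdf] at hprob
  rw [hset, ← measureReal_def, hprob]
  constructor
  · intro h
    refine ⟨fun j => stdGaussianCDF ((t j - m) / s), fun j => (t j - m) / s,
      fun j => stdGaussianCDF_mem_Ioo _, fun j => rfl, h, fun j => ?_⟩
    rw [div_mul_cancel₀ _ hs.ne']
    exact (add_sub_cancel m (t j)).le
  · rintro ⟨z, q, -, hqz, hsum, hle⟩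
    refine hsum.trans (Finset.sum_le_sum fun j _ => mul_le_mul_of_nonneg_left ?_ (hp j).le)
    rw [← hqz j]
    refine stdGaussianCDF_mono ((le_div_iff₀ hs).2 ?_)
    exact le_sub_iff_add_le'.2 (hle j)
end

section
/- Let E be a real vector space, S ⊆ E a convex set, P ≥ 1 an integer, and let c_1, …, c_P : E → ℝ be functions that are positive on S with log ∘ c_p convex on S for each p. Let σ_{p,q} ≥ 0 for all p, q ∈ {1, …, P}, let I ⊆ ℝ be a convex set (interval), and let h : ℝ → ℝ be positive on I with log ∘ h convex on I. Then the function (x, z) ↦ h(z) · √( Σ_{p=1}^P Σ_{q=1}^P σ_{p,q} c_p(x) c_q(x) ) is convex on S × I. -/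
/-- Nonnegative log-convex functions, in multiplicative form, so that zeros are allowed. -/
structure LogConvexOn {E : Type*} [AddCommGroup E] [Module ℝ E] (s : Set E) (f : E → ℝ) :
    Prop where
  nonneg : ∀ x ∈ s, 0 ≤ f x
  le_rpow_mul_rpow : ∀ x ∈ s, ∀ y ∈ s, ∀ a b : ℝ, 0 < a → 0 < b → a + b = 1 →
    f (a • x + b • y) ≤ f x ^ a * f y ^ b

theorem Real.sum_rpow_mul_rpow_le {ι : Type*} (t : Finset ι) {f g : ι → ℝ}
    (hf : ∀ i ∈ t, 0 ≤ f i) (hg : ∀ i ∈ t, 0 ≤ g i) {a b : ℝ} (ha : 0 < a) (hb : 0 < b)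
    (hab : a + b = 1) :
    ∑ i ∈ t, f i ^ a * g i ^ b ≤ (∑ i ∈ t, f i) ^ a * (∑ i ∈ t, g i) ^ b := by
  have hconj : Real.HolderConjugate a⁻¹ b⁻¹ := .inv_inv ha hb hab
  have key := Real.inner_le_Lp_mul_Lq_of_nonneg t hconj
    (fun i hi => Real.rpow_nonneg (hf i hi) a) (fun i hi => Real.rpow_nonneg (hg i hi) b)
  simp only [one_div, inv_inv] at key
  rwa [Finset.sum_congr rfl fun i hi => Real.rpow_rpow_inv (hf i hi) ha.ne',
    Finset.sum_congr rfl fun i hi => Real.rpow_rpow_inv (hg i hi) hb.ne'] at key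

namespace LogConvexOn

variable {E F : Type*} [AddCommGroup E] [Module ℝ E] [AddCommGroup F] [Module ℝ F]
  {s : Set E} {f g : E → ℝ}

theorem of_convexOn_log (hpos : ∀ x ∈ s, 0 < f x) (hlog : ConvexOn ℝ s (Real.log ∘ f)) :
    LogConvexOn s f where
  nonneg x hx := (hpos x hx).le
  le_rpow_mul_rpow x hx y hy a b ha hb hab := by
    have hfx := hpos x hx
    have hfy := hpos y hy
    rw [← Real.log_le_log_iff (hpos _ (hlog.1 hx hy ha.le hb.le hab)) (by positivity),
      Real.log_mul (by positivity) (by positivity), Real.log_rpow hfx, Real.log_rpow hfy]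
    exact hlog.2 hx hy ha.le hb.le hab

theorem const {k : ℝ} (hk : 0 ≤ k) : LogConvexOn s fun _ => k where
  nonneg _ _ := hk
  le_rpow_mul_rpow x _ y _ a b ha hb hab := by
    rw [← Real.rpow_add_of_nonneg hk ha.le hb.le, hab, Real.rpow_one]

theorem comp_linearMap {t : Set F} (hf : LogConvexOn s f) (L : F →ₗ[ℝ] E)
    (hL : ∀ x ∈ t, L x ∈ s) : LogConvexOn t fun x => f (L x) where
  nonneg x hx := hf.nonneg _ (hL x hx)
  le_rpow_mul_rpow x hx y hy a b ha hb hab := by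
    simpa only [map_add, map_smul] using
      hf.le_rpow_mul_rpow _ (hL x hx) _ (hL y hy) a b ha hb hab

theorem mul (hs : Convex ℝ s) (hf : LogConvexOn s f) (hg : LogConvexOn s g) :
    LogConvexOn s fun x => f x * g x where
  nonneg x hx := mul_nonneg (hf.nonneg x hx) (hg.nonneg x hx)
  le_rpow_mul_rpow x hx y hy a b ha hb hab := by
    have hfx := hf.nonneg x hx
    have hfy := hf.nonneg y hy
    rw [Real.mul_rpow hfx (hg.nonneg x hx), Real.mul_rpow hfy (hg.nonneg y hy),
      mul_mul_mul_comm]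
    exact mul_le_mul (hf.le_rpow_mul_rpow x hx y hy a b ha hb hab)
      (hg.le_rpow_mul_rpow x hx y hy a b ha hb hab)
      (hg.nonneg _ (hs hx hy ha.le hb.le hab)) (by positivity)

theorem sum {ι : Type*} (t : Finset ι) {f : ι → E → ℝ} (hf : ∀ i ∈ t, LogConvexOn s (f i)) :
    LogConvexOn s fun x => ∑ i ∈ t, f i x where
  nonneg x hx := Finset.sum_nonneg fun i hi => (hf i hi).nonneg x hx
  le_rpow_mul_rpow x hx y hy a b ha hb hab :=
    (Finset.sum_le_sum fun i hi => (hf i hi).le_rpow_mul_rpow x hx y hy a b ha hb hab).trans <|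
      Real.sum_rpow_mul_rpow_le t (fun i hi => (hf i hi).nonneg x hx)
        (fun i hi => (hf i hi).nonneg y hy) ha hb hab

theorem sqrt (hf : LogConvexOn s f) : LogConvexOn s fun x => Real.sqrt (f x) where
  nonneg _ _ := Real.sqrt_nonneg _
  le_rpow_mul_rpow x hx y hy a b ha hb hab := by
    have hfx := hf.nonneg x hx
    have hfy := hf.nonneg y hy
    refine (Real.sqrt_le_sqrt (hf.le_rpow_mul_rpow x hx y hy a b ha hb hab)).trans_eq ?_
    simp only [Real.sqrt_eq_rpow]
    rw [Real.mul_rpow (by positivity) (by positivity), ← Real.rpow_mul hfx, ← Real.rpow_mul hfy,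
      mul_comm a, mul_comm b, Real.rpow_mul hfx, Real.rpow_mul hfy]

theorem convexOn (hs : Convex ℝ s) (hf : LogConvexOn s f) : ConvexOn ℝ s f :=
  convexOn_iff_forall_pos.2 ⟨hs, fun x hx y hy a b ha hb hab =>
    (hf.le_rpow_mul_rpow x hx y hy a b ha hb hab).trans <|
      Real.geom_mean_le_arith_mean2_weighted ha.le hb.le (hf.nonneg x hx) (hf.nonneg y hy) hab⟩

end LogConvexOn

theorem stmt_6 {E : Type*} [AddCommGroup E] [Module ℝ E]
    (S : Set E) (hS : Convex ℝ S) (P : ℕ) (hP : 1 ≤ P)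
    (c : Fin P → E → ℝ) (hcpos : ∀ p, ∀ x ∈ S, 0 < c p x)
    (hclog : ∀ p, ConvexOn ℝ S (Real.log ∘ c p))
    (σ : Fin P → Fin P → ℝ) (hσ : ∀ p q, 0 ≤ σ p q)
    (I : Set ℝ) (hI : Convex ℝ I)
    (h : ℝ → ℝ) (hhpos : ∀ z ∈ I, 0 < h z) (hhlog : ConvexOn ℝ I (Real.log ∘ h)) :
    ConvexOn ℝ (S ×ˢ I)
      (fun xz : E × ℝ =>
        h xz.2 * Real.sqrt (∑ p, ∑ q, σ p q * c p xz.1 * c q xz.1)) := by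
  have hSI : Convex ℝ (S ×ˢ I) := hS.prod hI
  have hc (p : Fin P) : LogConvexOn (S ×ˢ I) fun xz : E × ℝ => c p xz.1 :=
    (LogConvexOn.of_convexOn_log (hcpos p) (hclog p)).comp_linearMap
      (LinearMap.fst ℝ E ℝ) fun _ hx => hx.1
  have hh : LogConvexOn (S ×ˢ I) fun xz : E × ℝ => h xz.2 :=
    (LogConvexOn.of_convexOn_log hhpos hhlog).comp_linearMap
      (LinearMap.snd ℝ E ℝ) fun _ hx => hx.2
  exact (hh.mul hSI (LogConvexOn.sum _ fun p _ => LogConvexOn.sum _ fun q _ =>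
    ((LogConvexOn.const (hσ p q)).mul hSI (hc p)).mul hSI (hc q)).sqrt).convexOn hSI
end

section
/- The function log ∘ Φ⁻¹ is convex on [Φ(1), 1): for all q₁, q₂ ∈ ℝ with q₁ ≥ 1 and q₂ ≥ 1, all t ∈ [0,1], and all q ∈ ℝ with Φ(q) = t·Φ(q₁) + (1−t)·Φ(q₂), one has log q ≤ t·log q₁ + (1−t)·log q₂. -/
open MeasureTheory ProbabilityTheory

theorem hasDerivAt_stdGaussianCDF (x : ℝ) :
    HasDerivAt stdGaussianCDF (gaussianPDFReal 0 1 x) x := by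
  have hcont : Continuous (gaussianPDFReal 0 1) := by
    unfold gaussianPDFReal
    fun_prop
  have hint : Integrable (gaussianPDFReal 0 1) := integrable_gaussianPDFReal 0 1
  have hcdf (t : ℝ) : stdGaussianCDF t = ∫ y in Set.Iic t, gaussianPDFReal 0 1 y := by
    rw [stdGaussianCDF, gaussianReal_apply_eq_integral 0 one_ne_zero, ENNReal.toReal_ofReal]
    exact integral_nonneg fun y => gaussianPDFReal_nonneg 0 1 y
  have heq : stdGaussianCDF =
      fun t => (∫ y in (0 : ℝ)..t, gaussianPDFReal 0 1 y) + stdGaussianCDF 0 := by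
    funext t
    rw [hcdf, hcdf, ← intervalIntegral.integral_Iic_sub_Iic hint.integrableOn hint.integrableOn]
    ring
  rw [heq]
  exact (hcont.integral_hasStrictDerivAt 0 x).hasDerivAt.add_const _

theorem strictMono_stdGaussianCDF : StrictMono stdGaussianCDF :=
  strictMono_of_hasDerivAt_pos hasDerivAt_stdGaussianCDF
    fun x => gaussianPDFReal_pos 0 1 x one_ne_zero

theorem antitoneOn_gaussianPDFReal_mul_self :
    AntitoneOn (fun x => gaussianPDFReal 0 1 x * x) (Set.Ici 1) := by
  intro x hx y hy hxy
  rw [Set.mem_Ici] at hx hy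
  have hx0 : 0 < x := by linarith
  have hratio : y / x ≤ Real.exp ((y ^ 2 - x ^ 2) / 2) := by
    have hle : y / x - 1 ≤ (y ^ 2 - x ^ 2) / 2 := by
      rw [div_sub_one hx0.ne', div_le_iff₀ hx0]
      nlinarith [mul_nonneg (sub_nonneg.2 hxy) (show (0 : ℝ) ≤ (y + x) * x / 2 - 1 by nlinarith)]
    calc y / x ≤ Real.exp (y / x - 1) := by linarith [Real.add_one_le_exp (y / x - 1)]
      _ ≤ _ := Real.exp_le_exp.2 hle
  have hkey : Real.exp (-y ^ 2 / 2) * y ≤ Real.exp (-x ^ 2 / 2) * x := by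
    rw [div_le_iff₀ hx0] at hratio
    calc Real.exp (-y ^ 2 / 2) * y
        ≤ Real.exp (-y ^ 2 / 2) * (Real.exp ((y ^ 2 - x ^ 2) / 2) * x) := by gcongr
      _ = Real.exp (-x ^ 2 / 2) * x := by
        rw [← mul_assoc, ← Real.exp_add]
        ring_nf
  simp only [gaussianPDFReal, sub_zero, NNReal.coe_one, mul_one, mul_assoc]
  gcongr

theorem concaveOn_stdGaussianCDF_comp_exp :
    ConcaveOn ℝ (Set.Ici 0) (fun u => stdGaussianCDF (Real.exp u)) := by
  have hderiv (u : ℝ) : HasDerivAt (fun u => stdGaussianCDF (Real.exp u))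
      (gaussianPDFReal 0 1 (Real.exp u) * Real.exp u) u :=
    (hasDerivAt_stdGaussianCDF _).comp u (Real.hasDerivAt_exp u)
  refine AntitoneOn.concaveOn_of_deriv (convex_Ici 0)
    (fun u _ => (hderiv u).continuousAt.continuousWithinAt)
    (fun u _ => (hderiv u).differentiableAt.differentiableWithinAt) ?_
  rw [interior_Ici]
  intro u hu v hv huv
  rw [(hderiv u).deriv, (hderiv v).deriv]
  exact antitoneOn_gaussianPDFReal_mul_self (Real.one_le_exp (le_of_lt hu))
    (Real.one_le_exp (le_of_lt hv)) (Real.exp_le_exp.2 huv)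

theorem stmt_8 (q₁ q₂ : ℝ) (h₁ : 1 ≤ q₁) (h₂ : 1 ≤ q₂)
    (t : ℝ) (ht : t ∈ Set.Icc (0 : ℝ) 1) (q : ℝ)
    (hq : stdGaussianCDF q = t * stdGaussianCDF q₁ + (1 - t) * stdGaussianCDF q₂) :
    Real.log q ≤ t * Real.log q₁ + (1 - t) * Real.log q₂ := by
  have ht0 : 0 ≤ t := ht.1
  have ht1 : 0 ≤ 1 - t := sub_nonneg.2 ht.2
  have hq1 : 1 ≤ q := by
    rw [← strictMono_stdGaussianCDF.le_iff_le, hq]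
    have hm₁ := mul_le_mul_of_nonneg_left (strictMono_stdGaussianCDF.monotone h₁) ht0
    have hm₂ := mul_le_mul_of_nonneg_left (strictMono_stdGaussianCDF.monotone h₂) ht1
    linarith
  have hconc := concaveOn_stdGaussianCDF_comp_exp.2 (Real.log_nonneg h₁) (Real.log_nonneg h₂)
    ht0 ht1 (add_sub_cancel t 1)
  simp only [smul_eq_mul] at hconc
  rw [Real.exp_log (by linarith), Real.exp_log (by linarith), ← hq,
    strictMono_stdGaussianCDF.le_iff_le] at hconc
  exact (Real.log_le_iff_le_exp (by linarith)).2 hconc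
end
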